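/- The Gaussian bridge ξ of random length τ is a Markov process with respect to its natural filtration: for all 0 ≤ t < u and every bounded measurable g : ℝ → ℝ, E[g(ξ_u) | F_t^ξ] = E[g(ξ_u) | σ(ξ_t)] ℙ-a.s. -/

import Mathlib

open MeasureTheory ProbabilityTheory Real Set

theorem MeasurableSpace.sup_eq_generateFrom_image2_inter {Ω : Type*} (m₁ m₂ : MeasurableSpace Ω) :
    m₁ ⊔ m₂ = MeasurableSpace.generateFrom
      (image2 (· ∩ ·) {s | MeasurableSet[m₁] s} {s | MeasurableSet[m₂] s}) := by
  apply le_antisymm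
  · refine sup_le (fun s hs => ?_) (fun s hs => ?_)
    · exact MeasurableSpace.measurableSet_generateFrom
        ⟨s, hs, univ, MeasurableSet.univ, inter_univ s⟩
    · exact MeasurableSpace.measurableSet_generateFrom
        ⟨univ, MeasurableSet.univ, s, hs, univ_inter s⟩
  · refine MeasurableSpace.generateFrom_le ?_
    rintro _ ⟨s, hs, r, hr, rfl⟩
    exact MeasurableSet.inter (m := m₁ ⊔ m₂) ((le_sup_left : m₁ ≤ m₁ ⊔ m₂) s hs)
      ((le_sup_right : m₂ ≤ m₁ ⊔ m₂) r hr)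

theorem isPiSystem_image2_inter_measurableSet {Ω : Type*} (m₁ m₂ : MeasurableSpace Ω) :
    IsPiSystem (image2 (· ∩ ·) {s | MeasurableSet[m₁] s} {s | MeasurableSet[m₂] s}) := by
  rintro _ ⟨s, hs, r, hr, rfl⟩ _ ⟨s', hs', r', hr', rfl⟩ -
  exact ⟨s ∩ s', hs.inter hs', r ∩ r', hr.inter hr', inter_inter_inter_comm s s' r r'⟩

/-- If `m₃` is independent of `m₁ ⊔ m₂` and `m₁` is independent of `m₂`, then `m₁` is independent
of `m₃ ⊔ m₂`. -/
theorem ProbabilityTheory.Indep.sup_right_of_indep_sup {Ω : Type*} {m₁ m₂ m₃ m : MeasurableSpace Ω}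
    {μ : Measure Ω} [IsProbabilityMeasure μ] (h₁ : m₁ ≤ m) (h₂ : m₂ ≤ m) (h₃ : m₃ ≤ m)
    (h : Indep m₃ (m₁ ⊔ m₂) μ) (h' : Indep m₁ m₂ μ) : Indep m₁ (m₃ ⊔ m₂) μ := by
  refine IndepSets.indep h₁ (sup_le h₃ h₂) (@MeasurableSpace.isPiSystem_measurableSet _ m₁)
    (isPiSystem_image2_inter_measurableSet m₃ m₂)
    (@MeasurableSpace.generateFrom_measurableSet _ m₁).symm
    (MeasurableSpace.sup_eq_generateFrom_image2_inter m₃ m₂) ?_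
  rw [IndepSets_iff]
  rintro s _ hs ⟨r, hr, w, hw, rfl⟩
  rw [Indep_iff] at h h'
  have hs' : MeasurableSet[m₁ ⊔ m₂] s := (le_sup_left : m₁ ≤ m₁ ⊔ m₂) s hs
  have hw' : MeasurableSet[m₁ ⊔ m₂] w := (le_sup_right : m₂ ≤ m₁ ⊔ m₂) w hw
  rw [show s ∩ (r ∩ w) = r ∩ (s ∩ w) from inter_left_comm s r w,
    h r (s ∩ w) hr (hs'.inter hw'), h r w hr hw', h' s w hs hw]
  ring

/-- Enlarging the conditioning `σ`-algebra by information independent of both the integrand and the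
original conditioning `σ`-algebra does not change the conditional expectation. -/
theorem MeasureTheory.condExp_sup_ae_eq_of_indep {Ω : Type*} {m₁ m₂ m₃ m : MeasurableSpace Ω}
    {μ : Measure Ω} [IsProbabilityMeasure μ] (h₁ : m₁ ≤ m) (h₃ : m₃ ≤ m) (h₂₃ : m₂ ≤ m₃)
    (hindep : Indep m₁ m₃ μ) {f : Ω → ℝ} (hf : Integrable f μ) (hfm : StronglyMeasurable[m₃] f) :
    μ[f | m₁ ⊔ m₂] =ᵐ[μ] μ[f | m₂] := by
  have h₂ : m₂ ≤ m := h₂₃.trans h₃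
  have hh : Integrable (μ[f | m₂]) μ := integrable_condExp
  have hD : Integrable (μ[f | m₂] - f) μ := hh.sub hf
  have hDm : StronglyMeasurable[m₃] (μ[f | m₂] - f) :=
    (stronglyMeasurable_condExp.mono h₂₃).sub hfm
  have key : ∀ s, MeasurableSet[m₁ ⊔ m₂] s → ∫ ω in s, (μ[f | m₂] - f) ω ∂μ = 0 := by
    intro s hs
    have huniv : ∫ ω, (μ[f | m₂] - f) ω ∂μ = 0 := by
      simp only [Pi.sub_apply]
      rw [integral_sub hh hf, integral_condExp h₂, sub_self]
    induction s, hs using MeasurableSpace.induction_on_inter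
      (MeasurableSpace.sup_eq_generateFrom_image2_inter m₁ m₂)
      (isPiSystem_image2_inter_measurableSet m₁ m₂) with
    | empty => simp
    | basic s hs =>
      obtain ⟨a, ha, b, hb, rfl⟩ := hs
      have hb0 : ∫ ω in b, (μ[f | m₂] - f) ω ∂μ = 0 := by
        simp only [Pi.sub_apply]
        rw [integral_sub hh.integrableOn hf.integrableOn, setIntegral_condExp h₂ hf hb, sub_self]
      have hind : IndepFun (a.indicator (fun _ => (1 : ℝ)))
          (b.indicator (μ[f | m₂] - f)) μ := by
        rw [IndepFun_iff_Indep]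
        refine indep_of_indep_of_le_left (indep_of_indep_of_le_right hindep ?_) ?_
        · exact (hDm.indicator (h₂₃ b hb)).measurable.comap_le
        · have : Measurable[m₁] (a.indicator fun _ => (1 : ℝ)) :=
            Measurable.indicator measurable_const ha
          exact this.comap_le
      have := hind.integral_mul_eq_mul_integral
        ((measurable_const.indicator (h₁ a ha)).aestronglyMeasurable)
        ((hD.indicator (h₂ b hb)).aestronglyMeasurable)
      rw [integral_indicator (h₂ b hb), hb0, mul_zero] at this
      rw [← integral_indicator ((h₁ a ha).inter (h₂ b hb)), ← this]
      congr 1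
      ext ω
      by_cases h1 : ω ∈ a <;> by_cases h2 : ω ∈ b <;> simp [h1, h2]
    | compl s hs ih =>
      rw [setIntegral_compl (sup_le h₁ h₂ s hs) hD, ih, huniv, sub_zero]
    | iUnion g hd hg ih =>
      rw [integral_iUnion (fun i => sup_le h₁ h₂ _ (hg i)) hd hD.integrableOn]
      simp only [ih, tsum_zero]
  symm
  refine ae_eq_condExp_of_forall_setIntegral_eq (sup_le h₁ h₂) hf (fun s _ _ => hh.integrableOn)
    (fun s hs _ => ?_) ?_
  · have := key s hs
    simp only [Pi.sub_apply] at this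
    rw [integral_sub hh.integrableOn hf.integrableOn] at this
    linarith
  · have : StronglyMeasurable[m₁ ⊔ m₂] (μ[f | m₂]) :=
      stronglyMeasurable_condExp.mono (le_sup_right : m₂ ≤ m₁ ⊔ m₂)
    exact this.aestronglyMeasurable

/-- If `T` is independent of `Y` and every section of `S` is null for the law of `Y`, then `(T, Y)`
almost surely avoids `S`. -/
theorem ProbabilityTheory.IndepFun.measure_preimage_prodMk_eq_zero {Ω α β : Type*}
    {m : MeasurableSpace Ω} {mα : MeasurableSpace α} {mβ : MeasurableSpace β} {μ : Measure Ω}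
    [IsProbabilityMeasure μ] {T : Ω → α} {Y : Ω → β} (hT : Measurable T) (hY : Measurable Y)
    (h : IndepFun T Y μ) {S : Set (α × β)} (hS : MeasurableSet S)
    (h0 : ∀ a, μ {ω | (a, Y ω) ∈ S} = 0) : μ {ω | (T ω, Y ω) ∈ S} = 0 := by
  have h1 := (indepFun_iff_map_prod_eq_prod_map_map hT.aemeasurable hY.aemeasurable).1 h
  have : IsProbabilityMeasure (μ.map Y) := Measure.isProbabilityMeasure_map hY.aemeasurable
  change μ ((fun ω => (T ω, Y ω)) ⁻¹' S) = 0
  rw [← Measure.map_apply (hT.prodMk hY) hS, h1, Measure.prod_apply hS]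
  refine lintegral_eq_zero_of_ae_eq_zero (Filter.Eventually.of_forall fun a => ?_)
  exact (Measure.map_apply hY (measurable_prodMk_left hS)).trans (h0 a)

/-- If `T` is independent of the `σ`-algebra `m'` and every section of `S` is null, then `(T ω, ω)`
almost surely avoids `S`. -/
theorem ProbabilityTheory.Indep.measure_preimage_prodMk_eq_zero {Ω α : Type*}
    {m' m : MeasurableSpace Ω} {mα : MeasurableSpace α} {μ : Measure Ω} [IsProbabilityMeasure μ]
    {T : Ω → α} (hT : Measurable T) (hm' : m' ≤ m) (h : Indep (mα.comap T) m' μ)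
    {S : Set (α × Ω)} (hS : MeasurableSet[mα.prod m'] S)
    (h0 : ∀ a, μ {ω | (a, ω) ∈ S} = 0) : μ {ω | (T ω, ω) ∈ S} = 0 :=
  @IndepFun.measure_preimage_prodMk_eq_zero _ _ _ m mα m' μ _ T id hT (measurable_id'' hm')
    ((@IndepFun_iff_Indep _ _ _ m mα m' T id μ).2 (by rwa [MeasurableSpace.comap_id])) S hS h0

/-- The product `σ`-algebra pulls back into every `σ`-algebra that makes all coordinates
measurable. -/
theorem MeasurableSpace.comap_pi_le_of_forall_measurable {Ω ι : Type*} {β : ι → Type*}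
    [∀ i, MeasurableSpace (β i)] {m : MeasurableSpace Ω} {A : Ω → ∀ i, β i}
    (h : ∀ i, Measurable fun ω => A ω i) : MeasurableSpace.comap A MeasurableSpace.pi ≤ m :=
  (measurable_pi_lambda _ h).comap_le

/-- A real process whose finite linear combinations are all Gaussian is a Gaussian process. -/
theorem ProbabilityTheory.isGaussianProcess_of_forall_map_sum_eq_gaussianReal {Ω T : Type*}
    {m : MeasurableSpace Ω} {μ : Measure Ω} {X : T → Ω → ℝ} (hX : ∀ t, Measurable (X t))
    (h : ∀ (I : Finset T) (c : I → ℝ), ∃ a v,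
      μ.map (fun ω => ∑ i, c i * X i ω) = gaussianReal a v) :
    IsGaussianProcess X μ where
  hasGaussianLaw I := by
    have hm : Measurable fun ω => I.restrict (X · ω) := measurable_pi_lambda _ fun i => hX i
    refine ⟨isGaussian_of_map_eq_gaussianReal fun L => ?_⟩
    classical
    obtain ⟨a, v, hav⟩ := h I fun i => L (Pi.single i 1)
    refine ⟨a, v, ?_⟩
    rw [← hav, Measure.map_map L.continuous.measurable hm]
    congr 1
    ext ω
    rw [Function.comp_apply, ← L.coe_coe, LinearMap.pi_apply_eq_sum_univ]
    refine Finset.sum_congr rfl fun i _ => ?_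
    simp only [smul_eq_mul, Finset.restrict, ContinuousLinearMap.coe_coe]
    rw [mul_comm]
    congr 2
    ext j
    simp [Pi.single_apply, eq_comm]

/-- The `σ`-algebra of all sets whose intersection with the `m`-measurable set `E` is
`m`-measurable. -/
@[reducible]
def MeasurableSpace.ofInter {Ω : Type*} (m : MeasurableSpace Ω) (E : Set Ω)
    (hE : MeasurableSet[m] E) : MeasurableSpace Ω where
  MeasurableSet' s := MeasurableSet[m] (E ∩ s)
  measurableSet_empty := by simp
  measurableSet_compl s hs := by
    rw [← sdiff_eq, ← sdiff_self_inter]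
    exact MeasurableSet.diff hE hs
  measurableSet_iUnion f hf := by
    rw [inter_iUnion]
    exact MeasurableSet.iUnion hf

theorem measurable_ofInter_of_eqOn {Ω β : Type*} {m : MeasurableSpace Ω} [MeasurableSpace β]
    {E : Set Ω} (hE : MeasurableSet[m] E) {Y Z : Ω → β} (hZ : Measurable[m] Z)
    (h : EqOn Y Z E) : Measurable[m.ofInter E hE] Y := by
  intro B hB
  change MeasurableSet[m] (E ∩ Y ⁻¹' B)
  rw [h.inter_preimage_eq]
  exact hE.inter (hZ hB)

/-- A process with continuous paths on `[a, ∞)` is jointly measurable there. -/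
theorem measurable_max_of_continuousOn_Ici {Ω : Type*} {m : MeasurableSpace Ω} {X : ℝ → Ω → ℝ}
    {a : ℝ} (hX : ∀ v, a ≤ v → Measurable (X v))
    (hc : ∀ ω, ContinuousOn (fun v => X v ω) (Ici a)) :
    Measurable fun p : ℝ × Ω => X (max p.1 a) p.2 := by
  refine measurable_uncurry_of_continuous_of_measurable (u := fun r ω => X (max r a) ω)
    (fun ω => ?_) (fun r => hX _ (le_max_right r a))
  exact (hc ω).comp_continuous (by fun_prop) fun r => le_max_right r a

/-- If `X` is centred Gaussian with covariance `ρ (min s t) * q (max s t)`, then the process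
`X s - ρ s / ρ t * X t` for `s ≤ t` is independent of the future of `X` after `t`. -/
theorem ProbabilityTheory.IsGaussianProcess.indepFun_sub_future {Ω : Type*}
    {m : MeasurableSpace Ω} {P : Measure Ω} [IsProbabilityMeasure P] {X : ℝ → Ω → ℝ}
    (hX : ∀ t, Measurable (X t)) (hG : IsGaussianProcess (fun (t : Ici (0 : ℝ)) => X t) P)
    (h0 : ∀ t, 0 ≤ t → ∫ ω, X t ω ∂P = 0) {ρ q : ℝ → ℝ}
    (hcov : ∀ s t, 0 ≤ s → s ≤ t → ∫ ω, X s ω * X t ω ∂P = ρ s * q t) {t : ℝ}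
    (ht : 0 ≤ t) (hρt : ρ t ≠ 0) :
    IndepFun (fun ω (s : Icc (0 : ℝ) t) => X s ω - ρ s / ρ t * X t ω)
      (fun ω (v : Ici t) => X v ω) P := by
  refine IsGaussianProcess.indepFun_of_covariance_eq_zero
    (X := fun (s : Icc (0 : ℝ) t) ω => X s ω - ρ s / ρ t * X t ω)
    (Y := fun (v : Ici t) ω => X v ω) ?_ (fun s => by fun_prop)
    (fun v => (hX v).aemeasurable) ?_
  · refine hG.of_isGaussianProcess fun s => ?_
    rcases s with s | v
    · refine ⟨{⟨s, s.2.1⟩, ⟨t, ht⟩},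
        ContinuousLinearMap.proj (R := ℝ) (φ := fun _ => ℝ) ⟨⟨s, s.2.1⟩, by simp⟩ -
          (ρ s / ρ t) • ContinuousLinearMap.proj (R := ℝ) (φ := fun _ => ℝ) ⟨⟨t, ht⟩, by simp⟩,
        fun ω => ?_⟩
      simp
    · refine ⟨{⟨v, ht.trans v.2⟩},
        ContinuousLinearMap.proj (R := ℝ) (φ := fun _ => ℝ) ⟨⟨v, ht.trans v.2⟩, by simp⟩,
        fun ω => ?_⟩
      simp
  · intro s v
    have hL : ∀ r : ℝ, 0 ≤ r → MemLp (X r) 2 P := fun r hr => (hG.hasGaussianLaw_eval ⟨r, hr⟩).memLp_two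
    have hc : ∀ r : ℝ, 0 ≤ r → r ≤ v → cov[X r, X v; P] = ρ r * q v := fun r hr hrv => by
      rw [covariance_eq_sub (hL r hr) (hL v (hr.trans hrv)), h0 r hr, zero_mul, sub_zero,
        ← hcov r v hr hrv]
      rfl
    rw [covariance_fun_sub_left (hL s s.2.1) ((hL t ht).const_mul _) (hL v (ht.trans v.2)),
      covariance_const_mul_left, hc s s.2.1 (s.2.2.trans v.2), hc t ht v.2]
    field_simp
    ring

/-- If the Cauchy-Schwarz inequality for `Y` and `Z` is strict and `Y - c * Z` is centred Gaussian,
then `Y - c * Z` is almost surely nonzero. -/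
theorem ProbabilityTheory.measure_sub_mul_eq_zero_of_sq_integral_mul_lt {Ω : Type*}
    {m : MeasurableSpace Ω} {P : Measure Ω} {Y Z : Ω → ℝ} (hY : Measurable Y) (hZ : Measurable Z)
    {c : ℝ} {v : NNReal} (hlaw : P.map (fun ω => Y ω - c * Z ω) = gaussianReal 0 v)
    (hlt : (∫ ω, Y ω * Z ω ∂P) ^ 2 < (∫ ω, Y ω * Y ω ∂P) * ∫ ω, Z ω * Z ω ∂P) :
    P {ω | Y ω - c * Z ω = 0} = 0 := by
  have hm : Measurable fun ω => Y ω - c * Z ω := by fun_prop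
  have hv0 : v ≠ 0 := by
    rintro rfl
    rw [gaussianReal_zero_var] at hlaw
    have hae : ∀ᵐ ω ∂P, Y ω = c * Z ω := by
      have : ∀ᵐ x ∂(P.map (fun ω => Y ω - c * Z ω)), x = 0 := by
        rw [hlaw, ae_dirac_eq]
        rfl
      filter_upwards [ae_of_ae_map hm.aemeasurable this] with ω hω
      linarith
    have h1 : ∫ ω, Y ω * Z ω ∂P = c * ∫ ω, Z ω * Z ω ∂P := by
      rw [← integral_const_mul]
      refine integral_congr_ae ?_
      filter_upwards [hae] with ω hω
      rw [hω]; ring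
    have h2 : ∫ ω, Y ω * Y ω ∂P = c * ∫ ω, Y ω * Z ω ∂P := by
      rw [← integral_const_mul]
      refine integral_congr_ae ?_
      filter_upwards [hae] with ω hω
      rw [hω]; ring
    rw [h2, h1] at hlt
    linarith
  have := nullSingletonClass_gaussianReal (μ := 0) hv0
  have h0 := measure_singleton (μ := gaussianReal 0 v) (0 : ℝ)
  rwa [← hlaw, Measure.map_apply hm (measurableSet_singleton 0)] at h0

/-- Let `N` be an `m₂`-measurable set on which `f` is constant, and suppose that off `N` the
`σ`-algebra `mF` coincides with `m₁ ⊔ m₂`, where `m₁` is independent of `m₂` and `f`. Then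
conditioning `f` on `mF` is the same as conditioning it on `m₂`. -/
theorem MeasureTheory.condExp_ae_eq_of_const_on_of_indep_off {Ω : Type*}
    {m₁ m₂ m₃ mF m : MeasurableSpace Ω} {μ : Measure Ω} [IsProbabilityMeasure μ]
    (h₁ : m₁ ≤ m) (h₃ : m₃ ≤ m) (hF : mF ≤ m) (h₂₃ : m₂ ≤ m₃) (h₂F : m₂ ≤ mF)
    (hindep : Indep m₁ m₃ μ) {f : Ω → ℝ} (hf : Integrable f μ) (hfm : StronglyMeasurable[m₃] f)
    {N : Set Ω} (hN : MeasurableSet[m₂] N) {c : ℝ} (hfN : f =ᵐ[μ.restrict N] fun _ => c)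
    (hNF : MeasurableSet[mF] Nᶜ) (hNs : MeasurableSet[m₁ ⊔ m₂] Nᶜ)
    (hle₁ : mF ≤ (m₁ ⊔ m₂).ofInter Nᶜ hNs) (hle₂ : m₁ ⊔ m₂ ≤ mF.ofInter Nᶜ hNF) :
    μ[f | mF] =ᵐ[μ] μ[f | m₂] := by
  have h₂ : m₂ ≤ m := h₂₃.trans h₃
  have hconst : ∀ m' : MeasurableSpace Ω, m' ≤ m → MeasurableSet[m'] N →
      μ[f | m'] =ᵐ[μ.restrict N] fun _ => c := fun m' hm' hN' => by
    have h1 : f - (fun _ => c) =ᵐ[μ.restrict N] 0 := by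
      filter_upwards [hfN] with ω hω
      simp [hω]
    have h2 := condExp_ae_eq_restrict_zero hN' h1
    have h3 := ae_restrict_of_ae (s := N) (condExp_sub hf (integrable_const c) m')
    filter_upwards [h2, h3] with ω h2 h3
    rw [h2, Pi.sub_apply, condExp_const hm'] at h3
    simp only [Pi.zero_apply] at h3
    linarith
  have hcompl : μ[f | mF] =ᵐ[μ.restrict Nᶜ] μ[f | m₁ ⊔ m₂] := by
    refine condExp_ae_eq_restrict_of_measurableSpace_eq_on hF (sup_le h₁ h₂) hNF fun s =>
      ⟨fun hs => ?_, fun hs => ?_⟩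
    · have : MeasurableSet[m₁ ⊔ m₂] (Nᶜ ∩ (Nᶜ ∩ s)) := hle₁ _ hs
      rwa [← inter_assoc, inter_self] at this
    · have : MeasurableSet[mF] (Nᶜ ∩ (Nᶜ ∩ s)) := hle₂ _ hs
      rwa [← inter_assoc, inter_self] at this
  have hsup := condExp_sup_ae_eq_of_indep h₁ h₃ h₂₃ hindep hf hfm
  have e₁ := (ae_restrict_iff' (h₂ _ hN)).1 ((hconst mF hF (h₂F _ hN)).trans
    (hconst m₂ h₂ hN).symm)
  have e₂ := (ae_restrict_iff' (hF _ hNF)).1 hcompl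
  filter_upwards [e₁, e₂, hsup] with ω h₁ h₂ h₃
  by_cases hω : ω ∈ N
  · exact h₁ hω
  · exact (h₂ hω).trans h₃

/-- The bridge ξ of random length τ is a Markov process w.r.t. its natural filtration:
for 0 ≤ t < u and g bounded measurable, E[g(ξ_u) | F_t^ξ] = E[g(ξ_u) | σ(ξ_t)] a.s. -/
theorem stmt_15
    {Ω : Type*} [MeasurableSpace Ω] (P : Measure Ω) [IsProbabilityMeasure P]
    (X : ℝ → Ω → ℝ)
    (hXmeas : ∀ t, Measurable (X t))
    (hGauss : ∀ (m : ℕ) (ts : Fin m → ℝ), (∀ i, 0 ≤ ts i) → ∀ c : Fin m → ℝ,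
      ∃ v : NNReal, Measure.map (fun ω => ∑ i, c i * X (ts i) ω) P = gaussianReal 0 v)
    (hXcont : ∀ ω, ContinuousOn (fun t => X t ω) (Set.Ici 0))
    (hX0 : ∀ᵐ ω ∂P, X 0 ω = 0)
    (R : ℝ → ℝ → ℝ)
    (hR : ∀ s t, R s t = ∫ ω, X s ω * X t ω ∂P)
    (hRpos : ∀ t, 0 < t → 0 < R t t)
    (hRnd : ∀ s t, 0 < s → 0 < t → s ≠ t → (R s t)^2 < R s s * R t t)
    (ξr : ℝ → ℝ → Ω → ℝ)
    (hξr : ∀ r t ω, ξr r t ω = X t ω - R t (max r t) / R (max r t) (max r t) * X (max r t) ω)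
    (τ : Ω → ℝ) (hτmeas : Measurable τ) (hτpos : ∀ ω, 0 < τ ω)
    (hindep : Indep (MeasurableSpace.comap τ inferInstance)
      (⨆ t ∈ Set.Ici (0:ℝ), MeasurableSpace.comap (X t) inferInstance) P)
    (F : ℝ → ℝ) (hF : ∀ t, F t = (P {ω | τ ω ≤ t}).toReal)
    (ξ : ℝ → Ω → ℝ) (hξ : ∀ t ω, ξ t ω = ξr (τ ω) t ω)
    (ρ q : ℝ → ℝ)
    (hfact : ∀ s t, 0 ≤ s → 0 ≤ t → R s t = ρ (min s t) * q (max s t))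
    (hρcont : ContinuousOn ρ (Set.Ici 0)) (hqcont : ContinuousOn q (Set.Ici 0))
    (hρ0 : ρ 0 = 0)
    (hρpos : ∀ t, 0 < t → 0 < ρ t) (hqpos : ∀ t, 0 < t → 0 < q t)
    (hρq : MonotoneOn (fun t => ρ t / q t) (Set.Ioi 0))
    (t u : ℝ) (ht : 0 ≤ t) (htu : t < u)
    (g : ℝ → ℝ) (hgmeas : Measurable g) (C : ℝ) (hgbdd : ∀ x, |g x| ≤ C) :
    P[(fun ω => g (ξ u ω))|⨆ s ∈ Set.Icc (0:ℝ) t,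
        MeasurableSpace.comap (ξ s) inferInstance] =ᵐ[P]
    P[(fun ω => g (ξ u ω))|MeasurableSpace.comap (ξ t) inferInstance] := by
  have hρ' : ∀ r, 0 < r → ρ r ≠ 0 := fun r hr => (hρpos r hr).ne'
  have hcov : ∀ s r, 0 ≤ s → s ≤ r → ∫ ω, X s ω * X r ω ∂P = ρ s * q r := fun s r hs hsr => by
    rw [← hR, hfact s r hs (hs.trans hsr), min_eq_left hsr, max_eq_right hsr]
  let Φ : ℝ → ℝ × Ω → ℝ := fun s p => X s p.2 - ρ s / ρ (max p.1 s) * X (max p.1 s) p.2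
  have hξΦ : ∀ s, 0 ≤ s → ∀ ω, ξ s ω = Φ s (τ ω, ω) := fun s hs ω => by
    have hM : 0 < max (τ ω) s := lt_max_of_lt_left (hτpos ω)
    rw [hξ, hξr, hfact _ _ hs hM.le, hfact _ _ hM.le hM.le, min_eq_left (le_max_right _ _),
      max_eq_right (le_max_right _ _), min_self, max_self,
      mul_div_mul_right _ _ (hqpos _ hM).ne']
  have hΦmeas : ∀ (m : MeasurableSpace Ω) (s : ℝ), 0 ≤ s → (∀ v, s ≤ v → Measurable[m] (X v)) →
      Measurable[@Prod.instMeasurableSpace _ _ _ m] (Φ s) := fun m s hs hm => by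
    have h1 : Measurable fun p : ℝ × Ω => X (max p.1 s) p.2 :=
      measurable_max_of_continuousOn_Ici hm fun ω => (hXcont ω).mono (Ici_subset_Ici.2 hs)
    have h2 : Measurable fun r : ℝ => ρ (max r s) :=
      (hρcont.comp_continuous (by fun_prop) fun r => hs.trans (le_max_right r s)).measurable
    exact ((hm s le_rfl).comp measurable_snd).sub
      (((h2.comp measurable_fst).const_div _).mul h1)
  have hξzero : ∀ s, 0 < s → ∀ ω, τ ω ≤ s → ξ s ω = 0 := fun s hs ω h => by
    simp only [hξΦ s hs.le ω, Φ, max_eq_right h, div_self (hρ' s hs), one_mul, sub_self]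
  have hξmeas : ∀ s, 0 ≤ s → Measurable (ξ s) := fun s hs => by
    rw [funext (hξΦ s hs)]
    exact (hΦmeas _ s hs fun v _ => hXmeas v).comp (hτmeas.prodMk measurable_id)
  rcases ht.eq_or_lt with rfl | ht0
  · simp
  have hsum : ∀ (I : Finset (Ici (0 : ℝ))) (c : I → ℝ), ∃ a v,
      P.map (fun ω => ∑ i, c i * X i ω) = gaussianReal a v := fun I c => by
    obtain ⟨v, hv⟩ := hGauss I.card (fun i => I.equivFin.symm i)
      (fun i => (I.equivFin.symm i).1.2) (fun i => c (I.equivFin.symm i))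
    refine ⟨0, v, ?_⟩
    rw [← hv]
    congr 1
    ext ω
    exact (Equiv.sum_comp I.equivFin.symm fun i => c i * X i ω).symm
  have hone : ∀ r, 0 ≤ r → ∃ v, P.map (X r) = gaussianReal 0 v := fun r hr => by
    simpa using hGauss 1 (fun _ => r) (fun _ => hr) 1
  have hmean : ∀ r, 0 ≤ r → ∫ ω, X r ω ∂P = 0 := fun r hr => by
    obtain ⟨v, hv⟩ := hone r hr
    have := integral_map (hXmeas r).aemeasurable (f := fun x : ℝ => x) (μ := P) (by fun_prop)
    rw [← this, hv, integral_id_gaussianReal]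
  have hG : IsGaussianProcess (fun (r : Ici (0 : ℝ)) => X r) P :=
    isGaussianProcess_of_forall_map_sum_eq_gaussianReal (fun r => hXmeas r) hsum
  have hind := hG.indepFun_sub_future hXmeas hmean hcov ht (hρ' t ht0)
  let A : Ω → Icc (0 : ℝ) t → ℝ := fun ω s => X s ω - ρ s / ρ t * X t ω
  let V : Ω → Ici t → ℝ := fun ω v => X v ω
  have hAmeas : Measurable A := measurable_pi_lambda _ fun s => by fun_prop
  have hVmeas : Measurable V := measurable_pi_lambda _ fun v => hXmeas v
  have hXmX : ∀ v, 0 ≤ v → Measurable[⨆ r ∈ Ici (0 : ℝ), MeasurableSpace.comap (X r) inferInstance]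
      (X v) := fun v hv => Measurable.of_comap_le
    (le_iSup₂ (f := fun r (_ : r ∈ Ici (0 : ℝ)) => MeasurableSpace.comap (X r) inferInstance) v hv)
  have hfuture : Indep (MeasurableSpace.comap A inferInstance)
      (MeasurableSpace.comap τ inferInstance ⊔ MeasurableSpace.comap V inferInstance) P := by
    refine Indep.sup_right_of_indep_sup hAmeas.comap_le hVmeas.comap_le hτmeas.comap_le
      (indep_of_indep_of_le_right hindep (sup_le ?_ ?_)) hind
    · exact MeasurableSpace.comap_pi_le_of_forall_measurable fun s =>
        (hXmX s s.2.1).sub ((hXmX t ht).const_mul _)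
    · exact MeasurableSpace.comap_pi_le_of_forall_measurable fun v => hXmX v (ht.trans v.2)
  have hξfuture : ∀ s, t ≤ s →
      Measurable[MeasurableSpace.comap τ inferInstance ⊔ MeasurableSpace.comap V inferInstance]
        (ξ s) := fun s hs => by
    rw [funext (hξΦ s (ht.trans hs))]
    refine (hΦmeas _ s (ht.trans hs) fun v hv => ?_).comp
      (Measurable.prodMk (Measurable.of_comap_le le_sup_left) measurable_id)
    exact Measurable.mono ((measurable_pi_apply (⟨v, hs.trans hv⟩ : Ici t)).comp
      (comap_measurable V)) le_sup_right le_rfl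
  have hnull : ∀ᵐ ω ∂P, ξ t ω = 0 → τ ω ≤ t := by
    have := Indep.measure_preimage_prodMk_eq_zero (S := {p : ℝ × Ω | t < p.1 ∧ Φ t p = 0}) hτmeas
      (iSup₂_le fun v _ => (hXmeas v).comap_le) hindep
      (MeasurableSet.inter
        (measurable_fst measurableSet_Ioi)
        (hΦmeas _ t ht (fun v hv => hXmX v (ht.trans hv)) (measurableSet_singleton 0)))
      fun r => ?_
    · rw [ae_iff]
      convert this using 3
      ext ω
      simp [hξΦ t ht, and_comm]
    · by_cases hr : t < r
      swap
      · simp [hr]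
      have hr0 : 0 < r := ht0.trans hr
      obtain ⟨v, hv⟩ := hGauss 2 ![t, r] (by simp [Fin.forall_fin_two, ht, hr0.le])
        ![1, -(ρ t / ρ r)]
      have hlaw : P.map (fun ω => X t ω - ρ t / ρ r * X r ω) = gaussianReal 0 v := by
        rw [← hv]
        simp [Fin.sum_univ_two, sub_eq_add_neg]
      have hlt := hRnd t r ht0 hr0 hr.ne
      simp only [hR] at hlt
      simpa [Φ, hr, max_eq_left hr.le] using
        measure_sub_mul_eq_zero_of_sq_integral_mul_lt (hXmeas t) (hXmeas r) hlaw hlt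
  have hξF : ∀ s ∈ Icc (0 : ℝ) t,
      Measurable[⨆ s ∈ Icc (0 : ℝ) t, MeasurableSpace.comap (ξ s) inferInstance] (ξ s) :=
    fun s hs => Measurable.of_comap_le
      (le_iSup₂ (f := fun s (_ : s ∈ Icc (0 : ℝ) t) => MeasurableSpace.comap (ξ s) inferInstance)
        s hs)
  have htt : t ∈ Icc (0 : ℝ) t := right_mem_Icc.2 ht
  have hN : MeasurableSet[MeasurableSpace.comap (ξ t) inferInstance] (ξ t ⁻¹' {0}) :=
    comap_measurable (ξ t) (measurableSet_singleton 0)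
  have hbridge : ∀ s ∈ Icc (0 : ℝ) t, ∀ ω ∈ (ξ t ⁻¹' {0})ᶜ,
      ξ s ω = X s ω - ρ s / ρ t * X t ω + ρ s / ρ t * ξ t ω := fun s hs ω hω => by
    have hlt : t < τ ω := by
      by_contra! h
      exact hω (hξzero t ht0 ω h)
    simp only [hξΦ s hs.1, hξΦ t ht, Φ, max_eq_left hlt.le, max_eq_left (hs.2.trans hlt.le)]
    field_simp [hρ' t ht0]
    ring
  refine condExp_ae_eq_of_const_on_of_indep_off (c := g 0) hAmeas.comap_le
    (sup_le hτmeas.comap_le hVmeas.comap_le)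
    (iSup₂_le fun s hs => (hξmeas s hs.1).comap_le) (hξfuture t le_rfl).comap_le
    (hξF t htt).comap_le hfuture ?_ (hgmeas.comp (hξfuture u htu.le)).stronglyMeasurable hN ?_
    ((hξF t htt).comap_le _ hN).compl
    ((le_sup_right (a := MeasurableSpace.comap A inferInstance) _ hN).compl) ?_ ?_
  · exact Integrable.of_bound
      (hgmeas.comp (hξmeas u (ht.trans htu.le))).aestronglyMeasurable C
      (Filter.Eventually.of_forall fun ω => hgbdd _)
  · rw [Filter.EventuallyEq, ae_restrict_iff' ((hξmeas t ht).comap_le _ hN)]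
    filter_upwards [hnull] with ω hω hωN
    simp [hξzero u (ht0.trans htu) ω ((hω hωN).trans htu.le)]
  · refine iSup₂_le fun s hs => Measurable.comap_le ?_
    refine measurable_ofInter_of_eqOn _
      (Z := fun ω => X s ω - ρ s / ρ t * X t ω + ρ s / ρ t * ξ t ω) ?_ (hbridge s hs)
    exact Measurable.add
      (Measurable.mono ((measurable_pi_apply (⟨s, hs⟩ : Icc (0 : ℝ) t)).comp
        (comap_measurable A)) le_sup_left le_rfl)
      ((Measurable.of_comap_le le_sup_right).const_mul _)
  · refine sup_le (MeasurableSpace.comap_pi_le_of_forall_measurable fun s => ?_) fun s hs =>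
      MeasurableSet.inter ((hξF t htt).comap_le _ hN).compl ((hξF t htt).comap_le s hs)
    refine measurable_ofInter_of_eqOn _ (Z := fun ω => ξ s ω - ρ s / ρ t * ξ t ω)
      ((hξF s s.2).sub ((hξF t htt).const_mul _)) fun ω hω => ?_
    simp only [A, hbridge s s.2 ω hω]
    ring
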